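/- arXiv:1109.3152 — 5 statements merged into one kernel-verified Lean document; each statement's English description precedes it below -/
import Mathlib

section
/- Let R be a commutative ℝ-algebra, let D_γ : R → R (γ ∈ Fin p) be ℝ-linear derivations, let g : Fin p → Fin p → R be symmetric with two-sided inverse matrix g̃, and let L : Fin p → Fin p → Fin p → R satisfy the antisymmetry L^θ_{αβ} = −L^θ_{βα}. Define the Levi-Civita-type coefficients H^α_{βγ} = (1/2)·Σ_ε g̃^{αε}·( D_γ(g_{εβ}) + D_β(g_{εγ}) − D_ε(g_{βγ}) + Σ_θ ( g_{θε}·L^θ_{γβ} − g_{βθ}·L^θ_{γε} − g_{θγ}·L^θ_{βε} ) ). Then for all α, β, γ: (i) D_γ(g_{αβ}) = Σ_ε ( H^ε_{αγ}·g_{εβ} + H^ε_{βγ}·g_{αε} ), i.e. the covariant derivative of g with these coefficients vanishes (metric compatibility, formula (5.3) of Theorem 5.1); and (ii) H^α_{βγ} − H^α_{γβ} = L^α_{γβ}, i.e. the associated connection is torsion-free (as asserted in Theorem 6.1). -/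
/-- If `A * B = 1` entrywise, then contracting with `B` and then with `A` is the identity. -/
theorem sum_mul_sum_mul_eq_of_mul_eq_one {ι R : Type*} [Fintype ι] [DecidableEq ι] [CommRing R]
    {A B : ι → ι → R} (h : ∀ i k, ∑ j, A i j * B j k = if i = k then 1 else 0)
    (x : ι → R) (i : ι) : ∑ j, A i j * ∑ k, B j k * x k = x i := by
  simp only [Finset.mul_sum]
  rw [Finset.sum_comm]
  simp only [← mul_assoc, ← Finset.sum_mul, h, ite_mul, one_mul, zero_mul, Finset.sum_ite_eq,
    Finset.mem_univ, if_true]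


/-- The Levi-Civita-type coefficients
`H^α_{βγ} = (1/2) Σ_ε g̃^{αε} ( D_γ g_{εβ} + D_β g_{εγ} - D_ε g_{βγ}
  + Σ_θ ( g_{θε} L^θ_{γβ} - g_{βθ} L^θ_{γε} - g_{θγ} L^θ_{βε} ) )`
are metric compatible and torsion free: `D_γ g_{αβ} = Σ_ε (H^ε_{αγ} g_{εβ} + H^ε_{βγ} g_{αε})`
and `H^α_{βγ} - H^α_{γβ} = L^α_{γβ}` (formula (5.3) of Theorem 5.1 and Theorem 6.1). -/
theorem levi_civita_type_connection_metric_compatible_torsion_free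
    {R : Type*} [CommRing R] [Algebra ℝ R]
    (p : ℕ) (hp : 0 < p)
    (D : Fin p → Derivation ℝ R R)
    (g gt : Fin p → Fin p → R)
    (hsym : ∀ α β, g α β = g β α)
    (hinv₁ : ∀ α β, ∑ ε, gt α ε * g ε β = if α = β then 1 else 0)
    (hinv₂ : ∀ α β, ∑ ε, g α ε * gt ε β = if α = β then 1 else 0)
    (L : Fin p → Fin p → Fin p → R)
    (hL : ∀ θ α β, L θ α β = - L θ β α)
    (H : Fin p → Fin p → Fin p → R)
    (hH : ∀ α β γ, H α β γ = ((1 : ℝ)/2) • ∑ ε, gt α ε *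
      (D γ (g ε β) + D β (g ε γ) - D ε (g β γ)
        + ∑ θ, (g θ ε * L θ γ β - g β θ * L θ γ ε - g θ γ * L θ β ε))) :
    (∀ α β γ, D γ (g α β) = ∑ ε, (H ε α γ * g ε β + H ε β γ * g α ε)) ∧
    (∀ α β γ, H α β γ - H α γ β = L α γ β) := by
  set c : R := algebraMap ℝ R (1 / 2)
  have hc : c + c = 1 := by
    rw [← map_add, add_halves, map_one]
  set M : Fin p → Fin p → Fin p → R := fun δ α β => ∑ θ, g δ θ * L θ α β with hM
  have hM_anti : ∀ δ α β, M δ α β = - M δ β α := fun δ α β => by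
    simp only [hM, ← Finset.sum_neg_distrib]
    exact Finset.sum_congr rfl fun θ _ => by rw [hL θ α β, mul_neg]
  set B : Fin p → Fin p → Fin p → R := fun ε β γ =>
    D γ (g ε β) + D β (g ε γ) - D ε (g β γ) + (M ε γ β - M β γ ε - M γ β ε) with hB
  have hHB : ∀ α β γ, H α β γ = ∑ ε, gt α ε * (c * B ε β γ) := fun α β γ => by
    rw [hH, Algebra.smul_def, Finset.mul_sum]
    refine Finset.sum_congr rfl fun ε _ => ?_
    have h_sum : ∑ θ, (g θ ε * L θ γ β - g β θ * L θ γ ε - g θ γ * L θ β ε) =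
        M ε γ β - M β γ ε - M γ β ε := by
      simp only [hM, ← Finset.sum_sub_distrib]
      exact Finset.sum_congr rfl fun θ _ => by rw [hsym θ ε, hsym θ γ]
    rw [h_sum]
    ring
  have h_lower : ∀ δ β γ, ∑ ε, g δ ε * H ε β γ = c * B δ β γ := fun δ β γ => by
    simp only [hHB]
    exact sum_mul_sum_mul_eq_of_mul_eq_one hinv₂ (fun ε => c * B ε β γ) δ
  refine ⟨fun α β γ => ?_, fun α β γ => ?_⟩
  · have h_split : ∑ ε, (H ε α γ * g ε β + H ε β γ * g α ε) = c * B β α γ + c * B α β γ := by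
      rw [← h_lower, ← h_lower, ← Finset.sum_add_distrib]
      exact Finset.sum_congr rfl fun ε _ => by rw [hsym ε β]; ring
    rw [h_split]
    simp only [hB]
    rw [hsym β α, hsym β γ, hsym α γ, hM_anti γ β α]
    linear_combination (-D γ (g α β)) * hc
  · have h_alt : ∀ ε, c * B ε β γ - c * B ε γ β = M ε γ β := fun ε => by
      simp only [hB]
      rw [hsym γ β, hM_anti ε β γ]
      linear_combination M ε γ β * hc
    rw [hHB, hHB, ← Finset.sum_sub_distrib]
    simp only [← mul_sub, h_alt]
    exact sum_mul_sum_mul_eq_of_mul_eq_one hinv₁ (fun θ => L θ γ β) α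
end

section
/- Let R be a commutative ℝ-algebra, let D_γ : R → R (γ ∈ Fin p) be ℝ-linear derivations, let g : Fin p → Fin p → R be symmetric with two-sided inverse matrix g̃, and let H̊^α_{βγ} (α, β, γ ∈ Fin p) be arbitrary elements of R. For each γ define C_{εβ}(γ) = D_γ(g_{εβ}) − Σ_d ( H̊^d_{εγ}·g_{dβ} + H̊^d_{βγ}·g_{εd} ) (the covariant derivative of g with respect to H̊) and set H^α_{βγ} = H̊^α_{βγ} + (1/2)·Σ_ε g̃^{αε}·C_{εβ}(γ). Then for all α, β, γ: D_γ(g_{αβ}) = Σ_ε ( H^ε_{αγ}·g_{εβ} + H^ε_{βγ}·g_{αε} ); that is, the corrected coefficients H make the covariant derivative of g vanish (first correction formula of (5.8) in Theorem 5.3). -/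
/-- Contracting a vector with a matrix after its right inverse gives the vector back. -/
theorem sum_mul_sum_mul_of_right_inverse {ι R : Type*} [Fintype ι] [DecidableEq ι] [CommRing R]
    {g gt : ι → ι → R} (h : ∀ i j, ∑ k, g i k * gt k j = if i = j then 1 else 0)
    (c : ι → R) (i : ι) : ∑ k, g i k * ∑ j, gt k j * c j = c i := by
  simp_rw [Finset.mul_sum, ← mul_assoc]
  rw [Finset.sum_comm]
  simp_rw [← Finset.sum_mul, h]
  simp


/-- Given an arbitrary distinguished connection `H̊^α_{βγ}`, the
corrected coefficients `H^α_{βγ} = H̊^α_{βγ} + (1/2) Σ_ε g̃^{αε} C_{εβ}(γ)`, where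
`C_{εβ}(γ) = D_γ g_{εβ} - Σ_d ( H̊^d_{εγ} g_{dβ} + H̊^d_{βγ} g_{εd} )` is the covariant
derivative of `g` with respect to `H̊`, make the covariant derivative of `g` vanish:
`D_γ g_{αβ} = Σ_ε ( H^ε_{αγ} g_{εβ} + H^ε_{βγ} g_{αε} )` (first formula of (5.8),
Theorem 5.3). -/
theorem corrected_connection_metric_compatible
    {R : Type*} [CommRing R] [Algebra ℝ R]
    (p : ℕ) (hp : 0 < p)
    (D : Fin p → Derivation ℝ R R)
    (g gt : Fin p → Fin p → R)
    (hsym : ∀ α β, g α β = g β α)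
    (hinv₁ : ∀ α β, ∑ ε, gt α ε * g ε β = if α = β then 1 else 0)
    (hinv₂ : ∀ α β, ∑ ε, g α ε * gt ε β = if α = β then 1 else 0)
    (H₀ : Fin p → Fin p → Fin p → R)
    (C : Fin p → Fin p → Fin p → R)
    (hC : ∀ ε β γ, C ε β γ =
      D γ (g ε β) - ∑ d, (H₀ d ε γ * g d β + H₀ d β γ * g ε d))
    (H : Fin p → Fin p → Fin p → R)
    (hH : ∀ α β γ, H α β γ = H₀ α β γ + ((1 : ℝ)/2) • ∑ ε, gt α ε * C ε β γ) :
    ∀ α β γ, D γ (g α β) = ∑ ε, (H ε α γ * g ε β + H ε β γ * g α ε) := by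
  intro α β γ
  have hCsym : C β α γ = C α β γ := by
    rw [hC, hC, hsym β α]
    congr 1
    refine Finset.sum_congr rfl fun d _ => ?_
    rw [hsym d α, hsym β d]
    ring
  have hα := sum_mul_sum_mul_of_right_inverse hinv₂ (fun ε => C ε α γ) β
  have hβ := sum_mul_sum_mul_of_right_inverse hinv₂ (fun ε => C ε β γ) α
  have hsplit : ∑ ε, (H ε α γ * g ε β + H ε β γ * g α ε) =
      ∑ ε, (H₀ ε α γ * g ε β + H₀ ε β γ * g α ε) +
        ((1 : ℝ) / 2) • (∑ ε, g β ε * ∑ d, gt ε d * C d α γ +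
          ∑ ε, g α ε * ∑ d, gt ε d * C d β γ) := by
    rw [← Finset.sum_add_distrib, Finset.smul_sum, ← Finset.sum_add_distrib]
    refine Finset.sum_congr rfl fun ε _ => ?_
    rw [hH, hH, hsym ε β]
    simp only [Algebra.smul_def]
    ring
  rw [hsplit, hα, hβ, hCsym, ← two_smul ℝ (C α β γ), smul_smul]
  norm_num [hC]
end

section
/- Let R be a commutative ℝ-algebra, let D_γ : R → R (γ ∈ Fin p) be ℝ-linear derivations, let g : Fin r → Fin r → R (written g^{ab}) be symmetric with two-sided inverse matrix g̃, and let H̊^a_{bγ} (a, b ∈ Fin r, γ ∈ Fin p) be arbitrary elements of R. For each γ define C^{ea}(γ) = D_γ(g^{ea}) − Σ_d ( H̊^e_{dγ}·g^{da} + H̊^a_{dγ}·g^{ed} ) and set H^a_{bγ} = H̊^a_{bγ} + (1/2)·Σ_e g̃_{be}·C^{ea}(γ). Then for all a, b, γ: D_γ(g^{ab}) = Σ_e ( H^a_{eγ}·g^{eb} + H^b_{eγ}·g^{ae} ); that is, the corrected coefficients H make the horizontal covariant derivative of the vertical metric g^{ab} vanish (the correction formula H^a_{bγ} = H̊^a_{bγ}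 + (1/2)·g̃_{be}·g^{ea}_{∘|γ} appearing in Theorems 5.1 and 5.3). -/
/-- Contracting `∑ f, gt e f * c f` with a row of a left inverse `g` of `gt` recovers `c`. -/
theorem sum_mul_sum_eq_of_inverse {ι R : Type*} [Fintype ι] [DecidableEq ι] [CommSemiring R]
    {g gt : ι → ι → R} (hinv : ∀ a b, ∑ e, g a e * gt e b = if a = b then 1 else 0)
    (c : ι → R) (a : ι) : ∑ e, g a e * ∑ f, gt e f * c f = c a := by
  simp_rw [Finset.mul_sum]
  rw [Finset.sum_comm]
  simp_rw [← mul_assoc, ← Finset.sum_mul, hinv]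
  simp


/-- Given an arbitrary distinguished connection `H̊^a_{bγ}` (with
horizontal indices `γ ∈ Fin p` and vertical indices in `Fin r`), the corrected
coefficients `H^a_{bγ} = H̊^a_{bγ} + (1/2) Σ_e g̃_{be} C^{ea}(γ)`, where
`C^{ea}(γ) = D_γ g^{ea} - Σ_d ( H̊^e_{dγ} g^{da} + H̊^a_{dγ} g^{ed} )`, make the
horizontal covariant derivative of the vertical metric `g^{ab}` vanish:
`D_γ g^{ab} = Σ_e ( H^a_{eγ} g^{eb} + H^b_{eγ} g^{ae} )` (Theorems 5.1 and 5.3). -/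
theorem corrected_connection_vertical_metric_compatible
    {R : Type*} [CommRing R] [Algebra ℝ R]
    (p r : ℕ) (hp : 0 < p) (hr : 0 < r)
    (D : Fin p → Derivation ℝ R R)
    (g gt : Fin r → Fin r → R)
    (hsym : ∀ a b, g a b = g b a)
    (hinv₁ : ∀ a b, ∑ e, gt a e * g e b = if a = b then 1 else 0)
    (hinv₂ : ∀ a b, ∑ e, g a e * gt e b = if a = b then 1 else 0)
    (H₀ : Fin r → Fin r → Fin p → R)
    (C : Fin r → Fin r → Fin p → R)
    (hC : ∀ e a γ, C e a γ =
      D γ (g e a) - ∑ d, (H₀ e d γ * g d a + H₀ a d γ * g e d))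
    (H : Fin r → Fin r → Fin p → R)
    (hH : ∀ a b γ, H a b γ = H₀ a b γ + ((1 : ℝ)/2) • ∑ e, gt b e * C e a γ) :
    ∀ a b γ, D γ (g a b) = ∑ e, (H a e γ * g e b + H b e γ * g a e) := by
  intro a b γ
  have hC_symm : C b a γ = C a b γ := by
    rw [hC, hC, hsym b a]
    congr 1
    refine Finset.sum_congr rfl fun d _ => ?_
    rw [hsym d a, hsym b d]
    ring
  have hH_contract : ∀ a b, ∑ e, H a e γ * g b e =
      ∑ e, H₀ a e γ * g b e + ((1 : ℝ) / 2) • C b a γ := by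
    intro a b
    rw [← sum_mul_sum_eq_of_inverse hinv₂ (fun f => C f a γ) b, Finset.smul_sum,
      ← Finset.sum_add_distrib]
    refine Finset.sum_congr rfl fun e _ => ?_
    rw [hH, add_mul, smul_mul_assoc, mul_comm (g b e) (∑ f, _)]
  simp_rw [hsym _ b, Finset.sum_add_distrib, hH_contract, hC_symm]
  have hhalf : ((1 : ℝ) / 2) • C a b γ + ((1 : ℝ) / 2) • C a b γ = C a b γ := by
    rw [← add_smul, add_halves, one_smul]
  have hCab := hC a b γ
  simp_rw [hsym _ b, Finset.sum_add_distrib] at hCab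
  linear_combination -hhalf - hCab
end

section
/- Let R be a commutative ℝ-algebra, let D_c : R → R (c ∈ Fin r) be ℝ-linear derivations, let g : Fin r → Fin r → R be symmetric with two-sided inverse matrix g^{··}, let H^a_{bc} satisfy metric compatibility D_c(g_{ab}) = Σ_d ( H^d_{ac}·g_{db} + H^d_{bc}·g_{ad} ) for all a,b,c, and let T^a_{bc} be antisymmetric in its lower indices (T^a_{bc} = −T^a_{cb}). Define H̃^a_{bc} = H^a_{bc} + (1/2)·Σ_e g^{ae}·( Σ_d ( g_{ed}·T^d_{bc} − g_{bd}·T^d_{ec} + g_{cd}·T^d_{be} ) ). Then: (i) H̃ is again metric compatible, D_c(g_{ab}) = Σ_d ( H̃^d_{ac}·g_{db} + H̃^d_{bc}·g_{ad} ) for all a,b,c; and (ii) H̃^a_{bc} − H̃^a_{cb} = H^a_{bc} − H^a_{cb} + T^a_{bc}; in particular, if H is symmetric in its lower indices then the antisymmetric part of H̃ is exactly the prescribed tensor T (Theorem 6.2, formulas (6.6) and (6.7), horizontal part). -/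
/-- If `M * N = 1` for square arrays, then contracting with `N` and then `M` is the identity. -/
lemma sum_mul_sum_mul_of_inverse {ι R : Type*} [Fintype ι] [DecidableEq ι] [CommRing R]
    {M N : ι → ι → R} (h : ∀ a b, ∑ e, M a e * N e b = if a = b then 1 else 0)
    (v : ι → R) (a : ι) : ∑ d, M a d * ∑ e, N d e * v e = v a := by
  calc ∑ d, M a d * ∑ e, N d e * v e = ∑ e, (∑ d, M a d * N d e) * v e := by
        simp only [Finset.mul_sum, Finset.sum_mul, ← mul_assoc]
        exact Finset.sum_comm
    _ = v a := by simp [h]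


/-- (Theorem 6.2, horizontal part.)  If `H^a_{bc}` is metric
compatible and the tensor `T^a_{bc}` is antisymmetric in its lower indices, then
`H̃^a_{bc} = H^a_{bc} + (1/2) Σ_e g^{ae} ( Σ_d ( g_{ed} T^d_{bc} - g_{bd} T^d_{ec}
+ g_{cd} T^d_{be} ) )` is again metric compatible, and
`H̃^a_{bc} - H̃^a_{cb} = H^a_{bc} - H^a_{cb} + T^a_{bc}`. -/
theorem prescribed_horizontal_torsion_connection
    {R : Type*} [CommRing R] [Algebra ℝ R]
    (r : ℕ) (hr : 0 < r)
    (D : Fin r → Derivation ℝ R R)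
    (g gup : Fin r → Fin r → R)
    (hsym : ∀ a b, g a b = g b a)
    (hinv₁ : ∀ a b, ∑ e, gup a e * g e b = if a = b then 1 else 0)
    (hinv₂ : ∀ a b, ∑ e, g a e * gup e b = if a = b then 1 else 0)
    (H : Fin r → Fin r → Fin r → R)
    (hH : ∀ a b c, D c (g a b) = ∑ d, (H d a c * g d b + H d b c * g a d))
    (T : Fin r → Fin r → Fin r → R)
    (hT : ∀ a b c, T a b c = - T a c b)
    (Ht : Fin r → Fin r → Fin r → R)
    (hHt : ∀ a b c, Ht a b c = H a b c + ((1 : ℝ)/2) • ∑ e, gup a e *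
      (∑ d, (g e d * T d b c - g b d * T d e c + g c d * T d b e))) :
    (∀ a b c, D c (g a b) = ∑ d, (Ht d a c * g d b + Ht d b c * g a d)) ∧
    (∀ a b c, Ht a b c - Ht a c b = H a b c - H a c b + T a b c) := by
  set A : Fin r → Fin r → Fin r → R := fun e b c =>
    ∑ d, (g e d * T d b c - g b d * T d e c + g c d * T d b e) with hA
  have hHt' : ∀ a b c, Ht a b c = H a b c + ((1 : ℝ) / 2) • ∑ e, gup a e * A e b c := hHt
  have lower : ∀ a b c, ∑ d, g a d * ∑ e, gup d e * A e b c = A a b c := fun a b c =>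
    sum_mul_sum_mul_of_inverse hinv₂ (fun e => A e b c) a
  have skew : ∀ a b c, A b a c + A a b c = 0 := by
    intro a b c
    rw [hA, ← Finset.sum_add_distrib]
    refine Finset.sum_eq_zero fun d _ => ?_
    rw [hT d b a]
    ring
  have antisymm : ∀ e b c, A e b c - A e c b = ∑ d, (g e d * ((2 : ℝ) • T d b c)) := by
    intro e b c
    rw [hA, ← Finset.sum_sub_distrib]
    refine Finset.sum_congr rfl fun d _ => ?_
    rw [hT d c b, hT d c e, hT d e b, two_smul]
    ring
  refine ⟨fun a b c => ?_, fun a b c => ?_⟩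
  · have key : ∑ d, (Ht d a c * g d b + Ht d b c * g a d) =
        ∑ d, (H d a c * g d b + H d b c * g a d) +
          ((1 : ℝ) / 2) • (∑ d, g b d * ∑ e, gup d e * A e a c +
            ∑ d, g a d * ∑ e, gup d e * A e b c) := by
      rw [← Finset.sum_add_distrib, Finset.smul_sum, ← Finset.sum_add_distrib]
      refine Finset.sum_congr rfl fun d _ => ?_
      rw [hHt', hHt', hsym d b, smul_add, ← mul_smul_comm, ← mul_smul_comm]
      ring
    rw [key, lower, lower, skew, smul_zero, add_zero, hH]
  · have key : ∑ e, gup a e * A e b c - ∑ e, gup a e * A e c b = (2 : ℝ) • T a b c := by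
      rw [← Finset.sum_sub_distrib]
      simp only [← mul_sub, antisymm]
      exact sum_mul_sum_mul_of_inverse hinv₁ (fun d => (2 : ℝ) • T d b c) a
    rw [hHt', hHt', add_sub_add_comm, ← smul_sub, key, smul_smul]
    norm_num
end

section
/- Let R be a commutative ℝ-algebra, let D^c : R → R (c ∈ Fin r) be ℝ-linear derivations, let g : Fin r → Fin r → R (written g^{ab}) be symmetric with two-sided inverse matrix g̃, let V_b^{ac} satisfy compatibility D^c(g^{ab}) = Σ_e ( V_e^{ac}·g^{eb} + V_e^{bc}·g^{ae} ) for all a,b,c, and let S_b^{ac} be antisymmetric in its upper indices (S_b^{ac} = −S_b^{ca}). Define Ṽ_b^{ac} = V_b^{ac} + (1/2)·Σ_e g̃_{be}·( Σ_d ( g^{ed}·S_d^{ac} − g^{ad}·S_d^{ec} + g^{cd}·S_d^{ae} ) ). Then: (i) Ṽ is again compatible, D^c(g^{ab}) = Σ_e ( Ṽ_e^{ac}·g^{eb} + Ṽ_e^{bc}·g^{ae} ) for all a,b,c; and (ii) Ṽ_b^{ac} − Ṽ_b^{ca} = V_b^{ac} − V_b^{ca} + S_b^{ac}; in particular, if V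 is symmetric in its upper indices then the antisymmetric part of Ṽ is exactly the prescribed tensor S (Theorem 6.2, formulas (6.6) and (6.7), vertical part). -/
/-- Contracting a vector with a matrix and then with a left inverse of it gives the vector back. -/
theorem sum_mul_sum_mul_of_left_inverse {ι R : Type*} [Fintype ι] [DecidableEq ι] [CommRing R]
    {A B : ι → ι → R} (h : ∀ a b, ∑ e, A a e * B e b = if a = b then 1 else 0)
    (v : ι → R) (a : ι) : ∑ e, A a e * ∑ f, B e f * v f = v a := by
  simp_rw [Finset.mul_sum, ← mul_assoc]
  rw [Finset.sum_comm]
  simp_rw [← Finset.sum_mul, h]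
  simp

/-- (Theorem 6.2, vertical part.)  If `V_b^{ac}` satisfies
`D^c g^{ab} = Σ_e ( V_e^{ac} g^{eb} + V_e^{bc} g^{ae} )` and the tensor `S_b^{ac}` is
antisymmetric in its upper indices, then
`Ṽ_b^{ac} = V_b^{ac} + (1/2) Σ_e g̃_{be} ( Σ_d ( g^{ed} S_d^{ac} - g^{ad} S_d^{ec}
+ g^{cd} S_d^{ae} ) )` is again compatible, and
`Ṽ_b^{ac} - Ṽ_b^{ca} = V_b^{ac} - V_b^{ca} + S_b^{ac}`. -/
theorem prescribed_vertical_torsion_connection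
    {R : Type*} [CommRing R] [Algebra ℝ R]
    (r : ℕ) (hr : 0 < r)
    (D : Fin r → Derivation ℝ R R)
    (g gt : Fin r → Fin r → R)
    (hsym : ∀ a b, g a b = g b a)
    (hinv₁ : ∀ a b, ∑ e, gt a e * g e b = if a = b then 1 else 0)
    (hinv₂ : ∀ a b, ∑ e, g a e * gt e b = if a = b then 1 else 0)
    -- `V b a c` stands for `V_b^{ac}`; `S b a c` stands for `S_b^{ac}`
    (V : Fin r → Fin r → Fin r → R)
    (hV : ∀ a b c, D c (g a b) = ∑ e, (V e a c * g e b + V e b c * g a e))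
    (S : Fin r → Fin r → Fin r → R)
    (hS : ∀ b a c, S b a c = - S b c a)
    (Vt : Fin r → Fin r → Fin r → R)
    (hVt : ∀ b a c, Vt b a c = V b a c + ((1 : ℝ)/2) • ∑ e, gt b e *
      (∑ d, (g e d * S d a c - g a d * S d e c + g c d * S d a e))) :
    (∀ a b c, D c (g a b) = ∑ e, (Vt e a c * g e b + Vt e b c * g a e)) ∧
    (∀ b a c, Vt b a c - Vt b c a = V b a c - V b c a + S b a c) := by
  set s : Fin r → Fin r → Fin r → R := fun e a c => ∑ d, g e d * S d a c with hs
  have s_antisymm : ∀ e a c, s e a c = - s e c a := fun e a c => by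
    simp only [hs, ← Finset.sum_neg_distrib]
    exact Finset.sum_congr rfl fun d _ => by rw [hS d a c, mul_neg]
  set K : Fin r → Fin r → Fin r → R := fun e a c => s e a c - s a e c + s c a e with hK
  have Vt_eq : ∀ b a c, Vt b a c = V b a c + ((1 : ℝ)/2) • ∑ e, gt b e * K e a c :=
    fun b a c => by
      simp only [hVt, hK, hs, Finset.sum_add_distrib, Finset.sum_sub_distrib]
  have raise : ∀ b a c, ∑ e, g b e * ∑ f, gt e f * K f a c = K b a c := fun b a c =>
    sum_mul_sum_mul_of_left_inverse hinv₂ (fun f => K f a c) b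
  refine ⟨fun a b c => ?_, fun b a c => ?_⟩
  · have split : ∑ e, (Vt e a c * g e b + Vt e b c * g a e)
        = ∑ e, (V e a c * g e b + V e b c * g a e)
          + ((1 : ℝ)/2) • (K b a c + K a b c) := by
      rw [← raise b a c, ← raise a b c, ← Finset.sum_add_distrib, Finset.smul_sum,
        ← Finset.sum_add_distrib]
      refine Finset.sum_congr rfl fun e _ => ?_
      rw [Vt_eq, Vt_eq, hsym e b]
      simp only [Algebra.smul_def]
      ring
    have K_skew : K b a c + K a b c = 0 := by
      simp only [hK]
      rw [s_antisymm c b a]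
      ring
    rw [split, K_skew, smul_zero, add_zero, hV]
  · have K_sub : ∀ e, K e a c - K e c a = (2 : ℝ) • s e a c := fun e => by
      simp only [hK, two_smul]
      rw [s_antisymm e c a, s_antisymm a c e, s_antisymm c e a]
      ring
    have lower : ∑ e, gt b e * K e a c - ∑ e, gt b e * K e c a = (2 : ℝ) • S b a c := by
      rw [← Finset.sum_sub_distrib]
      simp_rw [← mul_sub, K_sub, mul_smul_comm, ← Finset.smul_sum]
      rw [sum_mul_sum_mul_of_left_inverse hinv₁ (fun d => S d a c) b]
    rw [Vt_eq, Vt_eq, add_sub_add_comm, ← smul_sub, lower, smul_smul]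
    norm_num
end
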